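/- arXiv:2011.03293 — 3 statements merged into one kernel-verified Lean document; each statement's English description precedes it below -/
import Mathlib

section
/- Spurious local minima in the presence of regularization terms: assume (1/2)·(d_x + 2)·(d_x + 1) < n, let ᾱ := (β̄, 0) be such that φ is continuously differentiable on an open neighborhood of (β̄, 0) and twice differentiable at (β̄, 0), and let g : ℝ^p × ℝ^{q×d_x} → [0, ∞) satisfy g(0) = 0 and g(z) ≥ c·‖z‖² for all z in some open neighborhood U of the origin, where c > 0. Then for every C > 0 there exist uncountably many pairs (y_d, ν) ∈ Y × (0, ∞) such that ᾱ is a spurious local minimum of the regularized loss R(α) := ‖Ψ(α) − y_d‖_Y² + ν·g(α − ᾱ); more precisely: there exist ε > 0 and r > 0 with R(α) ≥ R(ᾱ) + ε·‖α − ᾱ‖² for all α with ‖α − ᾱ‖ ≤ r, and inf_α R(α) + C ≤ R(ᾱ). -/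
noncomputable section

/-- The norm `‖y‖_Y = ((1/(2n)) · Σ_k ‖y_k‖₂²)^{1/2}` on `Y = (ℝ^{d_y})^n`. -/
def normY {dy n : ℕ} (y : Fin n → Fin dy → ℝ) : ℝ :=
  Real.sqrt (1 / (2 * (n : ℝ)) * ∑ k, ∑ j, y k j ^ 2)

/-- The approximation scheme with linear lowest level:
`Ψ(β, A) = (φ(β, A·x^k))_{k=1}^n`. -/
def PsiLin {dx dy n p q : ℕ} (x : Fin n → Fin dx → ℝ)
    (φ : (Fin p → ℝ) × (Fin q → ℝ) → Fin dy → ℝ)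
    (α : (Fin p → ℝ) × (Fin q → Fin dx → ℝ)) : Fin n → Fin dy → ℝ :=
  fun k => φ (α.1, fun i => ∑ j, α.2 i j * x k j)

/-- The regularized squared loss `α ↦ ‖Ψ(α) − y‖_Y² + ν·g(α − ᾱ)`. -/
def regLoss {dx dy n p q : ℕ} (x : Fin n → Fin dx → ℝ)
    (φ : (Fin p → ℝ) × (Fin q → ℝ) → Fin dy → ℝ)
    (g : (Fin p → ℝ) × (Fin q → Fin dx → ℝ) → ℝ)
    (abar : (Fin p → ℝ) × (Fin q → Fin dx → ℝ)) (ν : ℝ)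
    (y : Fin n → Fin dy → ℝ) (α : (Fin p → ℝ) × (Fin q → Fin dx → ℝ)) : ℝ :=
  normY (PsiLin x φ α - y) ^ 2 + ν * g (α - abar)

open Filter Topology Asymptotics

/-- Second-order Taylor expansion with Peano remainder. -/
lemma taylor_two_isLittleO {E F : Type*} [NormedAddCommGroup E] [NormedSpace ℝ E]
    [NormedAddCommGroup F] [NormedSpace ℝ F] {f : E → F} {a : E} {D : E →L[ℝ] E →L[ℝ] F}
    (hf : ∀ᶠ y in 𝓝 a, DifferentiableAt ℝ f y) (hD : HasFDerivAt (fderiv ℝ f) D a) :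
    (fun h => f (a + h) - f a - fderiv ℝ f a h - (1 / 2 : ℝ) • D h h)
      =o[𝓝 0] fun h => ‖h‖ ^ 2 := by
  rw [isLittleO_iff]
  intro ε hε
  have hD' := (hasFDerivAt_iff_isLittleO_nhds_zero.mp hD).def hε
  have hf' : ∀ᶠ h in 𝓝 (0 : E), DifferentiableAt ℝ f (a + h) := by
    have : Tendsto (fun h : E => a + h) (𝓝 0) (𝓝 a) := by
      simpa using (continuous_const_add a).tendsto (0 : E)
    exact this.eventually hf
  obtain ⟨δ, hδ, hball⟩ := Metric.eventually_nhds_iff_ball.mp (hD'.and hf')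
  filter_upwards [Metric.ball_mem_nhds (0 : E) hδ] with h hh
  have hseg : ∀ t ∈ Set.Icc (0 : ℝ) 1, t • h ∈ Metric.ball (0 : E) δ := by
    intro t ht
    simp only [Metric.mem_ball, dist_zero_right, norm_smul, Real.norm_eq_abs,
      abs_of_nonneg ht.1] at hh ⊢
    nlinarith [norm_nonneg h, ht.2]
  have hderiv : ∀ t ∈ Set.Icc (0 : ℝ) 1, HasDerivWithinAt
      (fun t : ℝ => f (a + t • h) - t • fderiv ℝ f a h - (t ^ 2 / 2) • D h h)
      (fderiv ℝ f (a + t • h) h - fderiv ℝ f a h - t • D h h) (Set.Icc 0 1) t := by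
    intro t ht
    have hline : HasDerivAt (fun t : ℝ => a + t • h) h t := by
      simpa using ((hasDerivAt_id t).smul_const h).const_add a
    have hcomp := ((hball _ (hseg t ht)).2.hasFDerivAt).comp_hasDerivAt t hline
    have hlin : HasDerivAt (fun t : ℝ => t • fderiv ℝ f a h) (fderiv ℝ f a h) t := by
      simpa using (hasDerivAt_id t).smul_const (fderiv ℝ f a h)
    have hquad : HasDerivAt (fun t : ℝ => (t ^ 2 / 2) • D h h) (t • D h h) t := by
      have := ((hasDerivAt_pow 2 t).div_const 2).smul_const (D h h)
      simpa using this
    exact ((hcomp.sub hlin).sub hquad).hasDerivWithinAt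
  have hbound : ∀ t ∈ Set.Ico (0 : ℝ) 1,
      ‖fderiv ℝ f (a + t • h) h - fderiv ℝ f a h - t • D h h‖ ≤ ε * ‖h‖ ^ 2 := by
    intro t ht
    have ht' : t ∈ Set.Icc (0 : ℝ) 1 := ⟨ht.1, ht.2.le⟩
    have hop := (hball _ (hseg t ht')).1
    have happ := (fderiv ℝ f (a + t • h) - fderiv ℝ f a - D (t • h)).le_of_opNorm_le hop h
    simp only [sub_apply, map_smul, smul_apply] at happ
    refine happ.trans ?_
    rw [norm_smul, Real.norm_eq_abs, abs_of_nonneg ht.1]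
    have : t * ‖h‖ ≤ ‖h‖ := mul_le_of_le_one_left (norm_nonneg h) ht.2.le
    calc ε * (t * ‖h‖) * ‖h‖ ≤ ε * ‖h‖ * ‖h‖ := by gcongr
      _ = ε * ‖h‖ ^ 2 := by ring
  have hmv := norm_image_sub_le_of_norm_deriv_le_segment_01' hderiv hbound
  have heq : f (a + h) - f a - fderiv ℝ f a h - (1 / 2 : ℝ) • D h h =
      f (a + (1 : ℝ) • h) - (1 : ℝ) • fderiv ℝ f a h - ((1 : ℝ) ^ 2 / 2) • D h h
      - (f (a + (0 : ℝ) • h) - (0 : ℝ) • fderiv ℝ f a h - ((0 : ℝ) ^ 2 / 2) • D h h) := by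
    simp
    abel
  rw [heq]
  simpa using hmv

/-- If `n` exceeds the number of quadratic monomials in the variables `ι`, some nonzero weight
vector annihilates all products of two coordinates of `n` given points. -/
lemma exists_weights_orthogonal_quadratic {ι κ : Type*} [Fintype ι] [Fintype κ]
    (hcard : (Fintype.card ι + 1).choose 2 < Fintype.card κ) (X : κ → ι → ℝ) :
    ∃ w : κ → ℝ, w ≠ 0 ∧ ∀ i j, ∑ k, w k * (X k i * X k j) = 0 := by
  classical
  let T : (κ → ℝ) →ₗ[ℝ] (Sym2 ι → ℝ) :=
    LinearMap.pi fun s => ∑ k, ((s.map (X k)).mul) • LinearMap.proj k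
  have hlt : Module.finrank ℝ (Sym2 ι → ℝ) < Module.finrank ℝ (κ → ℝ) := by
    simpa [Sym2.card] using hcard
  obtain ⟨w, hw, hw0⟩ := (Submodule.ne_bot_iff _).mp
    (LinearMap.ker_ne_bot_of_finrank_lt (f := T) hlt)
  refine ⟨w, hw0, fun i j => ?_⟩
  have := congrFun (LinearMap.mem_ker.mp hw) s(i, j)
  simp only [T, LinearMap.pi_apply, LinearMap.sum_apply, LinearMap.smul_apply,
    LinearMap.proj_apply, Sym2.map_mk, Sym2.mul_mk, smul_eq_mul, Pi.zero_apply] at this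
  rw [← this]
  exact Finset.sum_congr rfl fun k _ => mul_comm _ _

/-- Weights annihilating all quadratic monomials of the points `X k` annihilate the second-order
expansion of `f` along the linear maps `z ↦ ∑ i, X k i • V i z`. -/
lemma weighted_sum_isLittleO {ι κ E F G : Type*} [Fintype ι] [Fintype κ]
    [NormedAddCommGroup E] [NormedSpace ℝ E] [NormedAddCommGroup F] [NormedSpace ℝ F]
    [NormedAddCommGroup G] [NormedSpace ℝ G] {f : E → F} {a : E}
    (hf : ∀ᶠ y in 𝓝 a, DifferentiableAt ℝ f y) (hD : DifferentiableAt ℝ (fderiv ℝ f) a)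
    (V : ι → G →L[ℝ] E) (X : κ → ι → ℝ) (w : κ → ℝ) (i₀ : ι) (hX : ∀ k, X k i₀ = 1)
    (hw : ∀ i j, ∑ k, w k * (X k i * X k j) = 0) :
    (fun z => ∑ k, w k • (f (a + ∑ i, X k i • V i z) - f a)) =o[𝓝 0] fun z => ‖z‖ ^ 2 := by
  have htaylor := taylor_two_isLittleO hf hD.hasFDerivAt
  set D := fderiv ℝ (fderiv ℝ f) a
  have hw1 : ∀ i, ∑ k, w k * X k i = 0 := fun i => by simpa [hX] using hw i i₀
  have hrem : ∀ k, (fun z => w k • (f (a + ∑ i, X k i • V i z) - f a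
      - fderiv ℝ f a (∑ i, X k i • V i z)
      - (1 / 2 : ℝ) • D (∑ i, X k i • V i z) (∑ i, X k i • V i z))) =o[𝓝 0]
      fun z => ‖z‖ ^ 2 := by
    intro k
    let T : G →L[ℝ] E := ∑ i, X k i • V i
    have hT : ∀ z, ∑ i, X k i • V i z = T z := fun z => by simp [T]
    simp only [hT]
    have htend : Tendsto T (𝓝 0) (𝓝 0) := by simpa using T.continuous.tendsto 0
    have hO : (fun z => ‖T z‖ ^ 2) =O[𝓝 0] fun z => ‖z‖ ^ 2 :=
      ((T.isBigO_id (𝓝 0)).norm_norm).pow 2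
    exact ((htaylor.comp_tendsto htend).trans_isBigO hO).const_smul_left (w k)
  have hsum := IsLittleO.sum (s := Finset.univ) fun k _ => hrem k
  refine hsum.congr_left fun z => ?_
  have hL : ∑ k, w k • fderiv ℝ f a (∑ i, X k i • V i z) = 0 := by
    simp only [map_sum, map_smul, Finset.smul_sum, smul_smul]
    rw [Finset.sum_comm]
    simp [← Finset.sum_smul, hw1]
  have hQ : ∑ k, w k • (1 / 2 : ℝ) • D (∑ i, X k i • V i z) (∑ i, X k i • V i z) = 0 := by
    have : ∀ k, w k • (1 / 2 : ℝ) • D (∑ i, X k i • V i z) (∑ i, X k i • V i z) =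
        ∑ i, ∑ j, (w k * (X k i * X k j)) • (1 / 2 : ℝ) • D (V i z) (V j z) := by
      intro k
      simp only [map_sum, map_smul, sum_apply,
        smul_apply, Finset.smul_sum, smul_smul]
      rw [Finset.sum_comm]
      refine Finset.sum_congr rfl fun i _ => Finset.sum_congr rfl fun j _ => ?_
      congr 1
      ring
    simp only [this]
    rw [Finset.sum_comm]
    refine Finset.sum_eq_zero fun i _ => ?_
    rw [Finset.sum_comm]
    simp [← Finset.sum_smul, hw]
  simp only [Finset.sum_apply, smul_sub, Finset.sum_sub_distrib]
  rw [hL, hQ, sub_zero, sub_zero]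

lemma normY_sq {dy n : ℕ} (y : Fin n → Fin dy → ℝ) :
    normY y ^ 2 = 1 / (2 * (n : ℝ)) * ∑ k, ∑ j, y k j ^ 2 :=
  Real.sq_sqrt (by positivity)

/-- The bilinear form whose quadratic form is `normY ^ 2`. -/
def innerY {dy n : ℕ} (y z : Fin n → Fin dy → ℝ) : ℝ :=
  1 / (2 * (n : ℝ)) * ∑ k, ∑ j, y k j * z k j

lemma normY_sub_smul_sq {dy n : ℕ} (y z : Fin n → Fin dy → ℝ) (s : ℝ) :
    normY (y - s • z) ^ 2 = normY y ^ 2 - 2 * s * innerY y z + s ^ 2 * normY z ^ 2 := by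
  simp only [normY_sq, innerY, Finset.mul_sum, ← Finset.sum_sub_distrib, ← Finset.sum_add_distrib]
  refine Finset.sum_congr rfl fun k _ => Finset.sum_congr rfl fun j _ => ?_
  simp only [Pi.sub_apply, Pi.smul_apply, smul_eq_mul]
  ring

lemma normY_neg_sq {dy n : ℕ} (y : Fin n → Fin dy → ℝ) : normY (-y) ^ 2 = normY y ^ 2 := by
  simp [normY_sq]

/-- The coordinate maps `V i` with `(b, A x) = V none (b, A) + ∑ j, x j • V (some j) (b, A)`. -/
def lowestLevelCoord (dx p q : ℕ) :
    Option (Fin dx) → ((Fin p → ℝ) × (Fin q → Fin dx → ℝ)) →L[ℝ] ((Fin p → ℝ) × (Fin q → ℝ))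
  | none => (ContinuousLinearMap.fst ℝ _ _).prod 0
  | some j => (0 : _ →L[ℝ] _).prod
      (ContinuousLinearMap.pi fun i =>
        ((ContinuousLinearMap.proj j).comp (ContinuousLinearMap.proj i)).comp
          (ContinuousLinearMap.snd ℝ (Fin p → ℝ) (Fin q → Fin dx → ℝ)))

/-- The homogenized point `(1, x)`. -/
def homogenize {dx : ℕ} (x : Fin dx → ℝ) : Option (Fin dx) → ℝ
  | none => 1
  | some j => x j

lemma sum_homogenize_smul_lowestLevelCoord {dx p q : ℕ} (x : Fin dx → ℝ)
    (z : (Fin p → ℝ) × (Fin q → Fin dx → ℝ)) :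
    ∑ i, homogenize x i • lowestLevelCoord dx p q i z = (z.1, fun i => ∑ j, z.2 i j * x j) := by
  rw [Fintype.sum_option]
  ext i
  · simp [homogenize, lowestLevelCoord, Prod.fst_sum]
  · simp [homogenize, lowestLevelCoord, Prod.snd_sum, mul_comm]

/-- There is a nonzero direction in `Y` to which `Ψ(ᾱ + z) - Ψ(ᾱ)` is orthogonal up to
second order. -/
lemma exists_innerY_PsiLin_isLittleO {dx dy n p q : ℕ} (hdy : 1 ≤ dy)
    (hbig : (dx + 2) * (dx + 1) < 2 * n) (x : Fin n → Fin dx → ℝ)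
    (φ : (Fin p → ℝ) × (Fin q → ℝ) → Fin dy → ℝ) (βbar : Fin p → ℝ)
    (hf : ∀ᶠ y in 𝓝 (βbar, (0 : Fin q → ℝ)), DifferentiableAt ℝ φ y)
    (hφ2 : DifferentiableAt ℝ (fderiv ℝ φ) (βbar, (0 : Fin q → ℝ))) :
    ∃ Z : Fin n → Fin dy → ℝ, Z ≠ 0 ∧
      (fun z => innerY (PsiLin x φ ((βbar, 0) + z) - PsiLin x φ (βbar, 0)) Z)
        =o[𝓝 0] fun z => ‖z‖ ^ 2 := by
  have hcard : (Fintype.card (Option (Fin dx)) + 1).choose 2 < Fintype.card (Fin n) := by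
    simp only [Fintype.card_option, Fintype.card_fin, Nat.choose_two_right, Nat.add_sub_cancel]
    exact Nat.div_lt_of_lt_mul hbig
  obtain ⟨w, hw0, hw⟩ := exists_weights_orthogonal_quadratic hcard fun k => homogenize (x k)
  refine ⟨fun k _ => w k, ?_, ?_⟩
  · intro h
    exact hw0 (funext fun k => congrFun (congrFun h k) ⟨0, hdy⟩)
  have hlo := weighted_sum_isLittleO hf hφ2 (lowestLevelCoord dx p q)
    (fun k => homogenize (x k)) w none (fun _ => rfl) hw
  have hsum := (IsLittleO.sum (s := Finset.univ)
    fun j _ => isLittleO_pi.mp hlo j).const_mul_left (1 / (2 * (n : ℝ)))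
  refine hsum.congr_left fun z => ?_
  simp only [sum_homogenize_smul_lowestLevelCoord, Finset.sum_apply, innerY]
  rw [Finset.sum_comm]
  congr 1
  refine Finset.sum_congr rfl fun k _ => Finset.sum_congr rfl fun j _ => ?_
  simp only [Pi.smul_apply, Pi.sub_apply, smul_eq_mul, PsiLin, Prod.fst_add, Prod.snd_add,
    Prod.mk_add_mk, zero_add, Pi.zero_apply, zero_mul, Finset.sum_const_zero]
  exact mul_comm _ _

/-- Far out along a ray from any base point, a cone approximating `Z` strictly better than `0`
does improves on the base point by an arbitrary amount. -/
lemma exists_scale_mem_of_cone {dy n : ℕ} {S : Set (Fin n → Fin dy → ℝ)}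
    (hcone : ∀ y ∈ S, ∀ s : ℝ, 0 < s → s • y ∈ S) {Z v : Fin n → Fin dy → ℝ} (hv : v ∈ S)
    (hlt : normY (v - Z) ^ 2 < normY Z ^ 2) (y₀ : Fin n → Fin dy → ℝ) {C : ℝ} (hC : 0 < C) :
    ∃ s : ℝ, 0 < s ∧ ∃ u ∈ S, normY (u - (y₀ + s • Z)) ^ 2 + C ≤ s ^ 2 * normY Z ^ 2 := by
  set δ := normY Z ^ 2 - normY (v - Z) ^ 2 with hδ
  have hδ0 : 0 < δ := sub_pos.mpr hlt
  set I := innerY (-y₀) (v - Z)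
  set K := normY (-y₀) ^ 2 + 2 * |I| + C with hK
  have hK0 : 0 ≤ K := by positivity
  have hs1 : 1 ≤ K / δ + 1 := by
    have := div_nonneg hK0 hδ0.le
    linarith
  have hsδ : K ≤ (K / δ + 1) * δ := by
    rw [add_mul, div_mul_cancel₀ _ hδ0.ne']
    linarith
  set s := K / δ + 1
  have hs0 : 0 < s := by linarith
  refine ⟨s, hs0, s • v, hcone v hv s hs0, ?_⟩
  have heq : s • v - (y₀ + s • Z) = -y₀ - (-s) • (v - Z) := by
    simp only [smul_sub, neg_smul]
    abel
  rw [heq, normY_sub_smul_sq]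
  have hI : s * I ≤ s * |I| := by gcongr; exact le_abs_self I
  have hquad : s * K ≤ s * (s * δ) := by gcongr
  have hle : normY (-y₀) ^ 2 + C ≤ s * (normY (-y₀) ^ 2 + C) :=
    le_mul_of_one_le_left (by positivity) hs1
  rw [hK, hδ] at hquad
  nlinarith

theorem regularized_spurious_minima
    (dx dy n p q : ℕ) (hn : 2 ≤ n) (hdx : 1 ≤ dx) (hdy : 1 ≤ dy)
    (hp : 1 ≤ p) (hq : 1 ≤ q)
    (hbig : (dx + 2) * (dx + 1) < 2 * n)
    (x : Fin n → Fin dx → ℝ)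
    (φ : (Fin p → ℝ) × (Fin q → ℝ) → Fin dy → ℝ)
    (hcone : ∀ y ∈ Set.range (PsiLin x φ), ∀ s : ℝ, 0 < s →
      s • y ∈ Set.range (PsiLin x φ))
    (hexpr : ∀ y : Fin n → Fin dy → ℝ, y ≠ 0 →
      sInf (Set.range fun α => normY (PsiLin x φ α - y) ^ 2) < normY y ^ 2)
    (βbar : Fin p → ℝ)
    (hφ1 : ∃ U : Set ((Fin p → ℝ) × (Fin q → ℝ)),
      IsOpen U ∧ (βbar, (0 : Fin q → ℝ)) ∈ U ∧ ContDiffOn ℝ 1 φ U)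
    (hφ2 : DifferentiableAt ℝ (fderiv ℝ φ) (βbar, (0 : Fin q → ℝ)))
    (g : (Fin p → ℝ) × (Fin q → Fin dx → ℝ) → ℝ)
    (hgnn : ∀ z, 0 ≤ g z) (hg0 : g 0 = 0)
    (hgq : ∃ c : ℝ, 0 < c ∧ ∃ U : Set ((Fin p → ℝ) × (Fin q → Fin dx → ℝ)),
      IsOpen U ∧ (0 : (Fin p → ℝ) × (Fin q → Fin dx → ℝ)) ∈ U ∧
      ∀ z ∈ U, c * ‖z‖ ^ 2 ≤ g z) :
    ∀ C : ℝ, 0 < C →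
      ¬ Set.Countable {yν : (Fin n → Fin dy → ℝ) × ℝ | 0 < yν.2 ∧
        (∃ ε > (0 : ℝ), ∃ r > (0 : ℝ),
          ∀ α : (Fin p → ℝ) × (Fin q → Fin dx → ℝ),
            ‖α - (βbar, (0 : Fin q → Fin dx → ℝ))‖ ≤ r →
            regLoss x φ g (βbar, 0) yν.2 yν.1 (βbar, 0)
                + ε * ‖α - (βbar, (0 : Fin q → Fin dx → ℝ))‖ ^ 2 ≤
              regLoss x φ g (βbar, 0) yν.2 yν.1 α) ∧
        sInf (Set.range (regLoss x φ g (βbar, 0) yν.2 yν.1)) + C ≤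
          regLoss x φ g (βbar, 0) yν.2 yν.1 (βbar, 0)} := by
  intro C hC
  obtain ⟨U, hUo, hUa, hU⟩ := hφ1
  have hf : ∀ᶠ y in 𝓝 (βbar, (0 : Fin q → ℝ)), DifferentiableAt ℝ φ y := by
    filter_upwards [hUo.mem_nhds hUa] with y hy
    exact (hU.differentiableOn one_ne_zero).differentiableAt (hUo.mem_nhds hy)
  obtain ⟨Z, hZ0, hZ⟩ := exists_innerY_PsiLin_isLittleO hdy hbig x φ βbar hf hφ2
  obtain ⟨_, ⟨α₁, rfl⟩, hα₁⟩ := exists_lt_of_csInf_lt (Set.range_nonempty _) (hexpr Z hZ0)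
  set abar : (Fin p → ℝ) × (Fin q → Fin dx → ℝ) := (βbar, 0)
  obtain ⟨s, hs, _, ⟨α₂, rfl⟩, hα₂⟩ := exists_scale_mem_of_cone hcone (Set.mem_range_self α₁) hα₁
    (PsiLin x φ abar) (add_pos hC one_pos)
  set yd := PsiLin x φ abar + s • Z
  have hbase : ∀ ν, regLoss x φ g abar ν yd abar = s ^ 2 * normY Z ^ 2 := by
    intro ν
    have := normY_sub_smul_sq 0 Z s
    simp only [zero_sub, normY_neg_sq] at this
    simp only [regLoss, yd, sub_self, hg0, mul_zero, add_zero, sub_add_cancel_left, normY_neg_sq]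
    rw [this]
    simp [normY_sq, innerY]
  intro hcount
  have hν0 : 0 < 1 / (g (α₂ - abar) + 1) := by
    have := hgnn (α₂ - abar)
    positivity
  refine Cardinal.Real.Ioo_countable_iff.not.mpr hν0.not_ge ((hcount.preimage (Prod.mk_right_injective yd)).mono ?_)
  rintro ν ⟨hνpos, hνlt⟩
  refine ⟨hνpos, ?_, ?_⟩
  · obtain ⟨c, hc, W, hWo, hW0, hW⟩ := hgq
    have hη : 0 < ν * c / (4 * s) := by positivity
    obtain ⟨r, hr, hball⟩ := Metric.eventually_nhds_iff_ball.mp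
      ((hZ.def hη).and (hWo.mem_nhds hW0))
    refine ⟨ν * c / 2, by positivity, r / 2, by positivity, fun α hα => ?_⟩
    obtain ⟨hlo, hαW⟩ := hball (α - abar) (by rw [mem_ball_zero_iff]; linarith)
    have hgα := hW _ hαW
    rw [add_sub_cancel, Real.norm_eq_abs, norm_pow, norm_norm] at hlo
    have hlo' := mul_le_mul_of_nonneg_left ((le_abs_self _).trans hlo) hs.le
    have hcancel : s * (ν * c / (4 * s) * ‖α - abar‖ ^ 2) = ν * c / 4 * ‖α - abar‖ ^ 2 := by
      field_simp
    have hsplit : PsiLin x φ α - yd = (PsiLin x φ α - PsiLin x φ abar) - s • Z := by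
      simp only [yd]
      abel
    rw [hbase]
    simp only [regLoss]
    rw [hsplit, normY_sub_smul_sq]
    have hsq := sq_nonneg (normY (PsiLin x φ α - PsiLin x φ abar))
    have hνg := mul_le_mul_of_nonneg_left hgα hνpos.le
    linarith
  · rw [hbase]
    have hbdd : BddBelow (Set.range (regLoss x φ g abar ν yd)) := by
      refine ⟨0, ?_⟩
      rintro _ ⟨α, rfl⟩
      exact add_nonneg (sq_nonneg _) (mul_nonneg hνpos.le (hgnn _))
    have hinf := csInf_le hbdd (Set.mem_range_self α₂)
    have hνg : ν * g (α₂ - abar) ≤ 1 := by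
      have hg := hgnn (α₂ - abar)
      have := (lt_div_iff₀ (by linarith)).mp hνlt
      nlinarith
    simp only [regLoss] at hinf ⊢
    linarith
end
end

section
/- Separation lemma: let d, n ∈ ℕ with d ≥ 1 and let x¹, …, xⁿ ∈ ℝ^d be pairwise distinct. Then for every l ∈ {1, …, n} there exist a matrix A ∈ ℝ^{2×d} and a vector b ∈ ℝ² such that A·x^k + b ∈ (−∞, 0)² ∪ (0, ∞)² for every k ≠ l (i.e., both components of A·x^k + b are negative or both are positive), and A·x^l + b ∈ (0, ∞) × (−∞, 0) (the first component is positive and the second is negative). -/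
/-- For finitely many distinct points, some linear functional has values at the other points
whose distance from its value at `x l` is bounded below by a positive constant. -/
lemma exists_dotProduct_gap {ι κ : Type*} [Finite ι] [Fintype κ]
    (x : ι → κ → ℝ) (hx : Function.Injective x) (l : ι) :
    ∃ (a : κ → ℝ) (ε : ℝ), 0 < ε ∧
      ∀ k, k ≠ l → ε < |∑ j, a j * x k j - ∑ j, a j * x l j| := by
  classical
  obtain ⟨f, hf⟩ := Module.exists_dual_forall_apply_ne_zero (K := ℝ)
    (fun k : {k // k ≠ l} => x k - x l) (fun k => sub_ne_zero.2 (hx.ne k.2))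
  have hf_sum (v : κ → ℝ) : ∑ j, f (fun i => if j = i then 1 else 0) * v j = f v := by
    simp [f.pi_apply_eq_sum_univ v, mul_comm]
  have h_gap : ∀ᶠ ε in nhdsWithin (0 : ℝ) (Set.Ioi 0),
      ∀ k : {k // k ≠ l}, ε < |f (x k - x l)| :=
    Filter.eventually_all.2 fun k =>
      (eventually_lt_nhds (abs_pos.2 (hf k))).filter_mono nhdsWithin_le_nhds
  obtain ⟨ε, hε, h_pos⟩ := (h_gap.and self_mem_nhdsWithin).exists
  refine ⟨fun j => f (fun i => if j = i then 1 else 0), ε, h_pos, fun k hk => ?_⟩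
  rw [hf_sum, hf_sum, ← map_sub]
  exact hε ⟨k, hk⟩

theorem separation_lemma (d n : ℕ) (hd : 1 ≤ d)
    (x : Fin n → Fin d → ℝ) (hx : Function.Injective x) (l : Fin n) :
    ∃ (A : Fin 2 → Fin d → ℝ) (b : Fin 2 → ℝ),
      (∀ k : Fin n, k ≠ l →
        (∀ i : Fin 2, (∑ j, A i j * x k j) + b i < 0) ∨
        (∀ i : Fin 2, 0 < (∑ j, A i j * x k j) + b i)) ∧
      0 < (∑ j, A 0 j * x l j) + b 0 ∧
      (∑ j, A 1 j * x l j) + b 1 < 0 := by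
  obtain ⟨a, ε, hε, h_gap⟩ := exists_dotProduct_gap x hx l
  refine ⟨fun _ => a, ![ε - ∑ j, a j * x l j, -ε - ∑ j, a j * x l j], fun k hk => ?_, ?_, ?_⟩
  · rcases lt_abs.1 (h_gap k hk) with h | h
    · right
      simp only [Fin.forall_fin_two, Matrix.cons_val_zero, Matrix.cons_val_one]
      constructor <;> linarith
    · left
      simp only [Fin.forall_fin_two, Matrix.cons_val_zero, Matrix.cons_val_one]
      constructor <;> linarith
  · simpa using hε
  · simpa using hε
end

section
/- Conicity and improved expressiveness of free-knot linear spline interpolation: the image Ψ(D) ⊆ ℝ^n is a cone, i.e., if y ∈ Ψ(D) and s > 0 then s·y ∈ Ψ(D); for every y_d ∈ ℝ^n with y_d ≠ 0 one has inf_{(β,γ) ∈ D} ‖Ψ(β, γ) − y_d‖_Y² < ‖y_d‖_Y²; and Θ(Ψ) ≤ 1 − 1/n. -/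
noncomputable section

/-- The norm `‖y‖_Y = ((1/(2n)) · Σ_k y_k²)^{1/2}` on `ℝ^n`. -/
def normY1 {n : ℕ} (y : Fin n → ℝ) : ℝ :=
  Real.sqrt (1 / (2 * (n : ℝ)) * ∑ k, y k ^ 2)

/-- The free-knot linear spline with coefficients `β` and (strictly increasing) knots `γ`:
it equals `β 0` for `t ≤ γ 0`, equals `β (p-1)` for `t > γ (p-1)`, and interpolates linearly
between `(γ j, β j)` and `(γ (j+1), β (j+1))` on `(γ j, γ (j+1)]`.  (For strictly monotone `γ`
the three groups of conditions below are mutually exclusive, so the sum realizes exactly the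
piecewise definition.) -/
def splineVal (p : ℕ) (hp : 0 < p) (β γ : Fin p → ℝ) (t : ℝ) : ℝ :=
  (if t ≤ γ ⟨0, hp⟩ then β ⟨0, hp⟩ else 0)
  + (if γ ⟨p - 1, by omega⟩ < t then β ⟨p - 1, by omega⟩ else 0)
  + ∑ j : Fin (p - 1),
      if γ ⟨j.val, by have := j.isLt; omega⟩ < t ∧ t ≤ γ ⟨j.val + 1, by have := j.isLt; omega⟩ then
        ((γ ⟨j.val + 1, by have := j.isLt; omega⟩ - t) * β ⟨j.val, by have := j.isLt; omega⟩
          + (t - γ ⟨j.val, by have := j.isLt; omega⟩) * β ⟨j.val + 1, by have := j.isLt; omega⟩)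
          / (γ ⟨j.val + 1, by have := j.isLt; omega⟩ - γ ⟨j.val, by have := j.isLt; omega⟩)
      else 0

/-- The map `Ψ : D → ℝ^n` of the free-knot interpolation scheme. -/
def splinePsi (p n : ℕ) (hp : 0 < p) (x : Fin n → ℝ) (β γ : Fin p → ℝ) : Fin n → ℝ :=
  fun k => splineVal p hp β γ (x k)

/-- The image `Ψ(D)` of the admissible set `D = {(β, γ) : γ strictly increasing}`. -/
def splineImage (p n : ℕ) (hp : 0 < p) (x : Fin n → ℝ) : Set (Fin n → ℝ) :=
  {y | ∃ β γ : Fin p → ℝ, StrictMono γ ∧ y = splinePsi p n hp x β γ}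

/-- The optimal squared loss `inf_{(β,γ) ∈ D} ‖Ψ(β,γ) − y‖_Y²`. -/
def splineLossInf (p n : ℕ) (hp : 0 < p) (x : Fin n → ℝ) (y : Fin n → ℝ) : ℝ :=
  sInf {r : ℝ | ∃ β γ : Fin p → ℝ, StrictMono γ ∧
    r = normY1 (splinePsi p n hp x β γ - y) ^ 2}

/-- The worst-case error bound `Θ(Ψ)` of the scheme over unit label vectors. -/
def splineTheta (p n : ℕ) (hp : 0 < p) (x : Fin n → ℝ) : ℝ :=
  sSup {t : ℝ | ∃ y : Fin n → ℝ, normY1 y = 1 ∧ t = splineLossInf p n hp x y}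

open Filter Topology in
/-- Distinct values of an injective family are separated from a given one by a positive gap. -/
lemma exists_pos_gap {n : ℕ} {x : Fin n → ℝ} (hx : Function.Injective x) (k : Fin n) :
    ∃ δ : ℝ, 0 < δ ∧ ∀ i, i ≠ k → δ ≤ |x i - x k| := by
  have h : ∀ᶠ δ : ℝ in 𝓝[>] 0, ∀ i, i ≠ k → δ ≤ |x i - x k| := by
    refine eventually_all.2 fun i => ?_
    by_cases hik : i = k
    · simp [hik]
    · have hpos : 0 < |x i - x k| := abs_pos.2 (sub_ne_zero.2 (hx.ne hik))
      filter_upwards [mem_nhdsWithin_of_mem_nhds (Iio_mem_nhds hpos)] with δ hδ _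
      exact le_of_lt hδ
  obtain ⟨δ, hδ, hδ0⟩ := (h.and (self_mem_nhdsWithin (s := Set.Ioi (0 : ℝ)))).exists
  exact ⟨δ, hδ0, hδ⟩

lemma splineVal_smul (p : ℕ) (hp : 0 < p) (β γ : Fin p → ℝ) (s t : ℝ) :
    splineVal p hp (s • β) γ t = s * splineVal p hp β γ t := by
  simp only [splineVal, mul_add, Finset.mul_sum, Pi.smul_apply, smul_eq_mul, mul_ite, mul_zero]
  congr 1
  refine Finset.sum_congr rfl fun j _ => ?_
  split_ifs <;> ring

/-- The hat function: equispaced knots with the second one at `c`, and only the second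
coefficient nonzero. -/
lemma splineVal_hat_center {p : ℕ} (hp₀ : 0 < p) (hp : 3 ≤ p) (b c : ℝ) {δ : ℝ} (hδ : 0 < δ) :
    splineVal p hp₀ (fun j => if j.val = 1 then b else 0)
      (fun j => c + δ * ((j.val : ℝ) - 1)) c = b := by
  have h0 : ¬ c ≤ c + δ * (((0 : ℕ) : ℝ) - 1) := by push_cast; linarith
  have hlast : ¬ c + δ * (((p - 1 : ℕ) : ℝ) - 1) < c := by
    have : (2 : ℝ) ≤ ((p - 1 : ℕ) : ℝ) := by exact_mod_cast (by omega : 2 ≤ p - 1)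
    nlinarith
  unfold splineVal
  rw [if_neg h0, if_neg hlast, Finset.sum_eq_single ⟨0, by omega⟩]
  · simp [hδ, hδ.ne']
  · intro j _ hj
    have hj1 : (1 : ℝ) ≤ (j.val : ℝ) := by
      exact_mod_cast Nat.one_le_iff_ne_zero.2 fun h => hj (Fin.ext h)
    refine if_neg fun h => ?_
    have := h.1
    nlinarith
  · simp

lemma splineVal_hat_of_le {p : ℕ} (hp₀ : 0 < p) (hp : 3 ≤ p) (b c : ℝ) {δ t : ℝ} (hδ : 0 < δ)
    (ht : δ ≤ |t - c|) :
    splineVal p hp₀ (fun j => if j.val = 1 then b else 0)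
      (fun j => c + δ * ((j.val : ℝ) - 1)) t = 0 := by
  have hlast : p - 1 ≠ 1 := by omega
  unfold splineVal
  simp only [hlast, if_false, ite_self, zero_ne_one, zero_add]
  refine Finset.sum_eq_zero fun j _ => ?_
  split_ifs with h h0 h1 h1
  · omega
  · obtain ⟨hl, hr⟩ := h
    rw [h0] at hl hr ⊢
    push_cast at hl hr ⊢
    rcases le_abs.1 ht with h | h
    · have : t = c + δ := by linarith
      rw [this]; ring
    · linarith
  · obtain ⟨hl, hr⟩ := h
    have h0 : j.val = 0 := by omega
    rw [h0] at hl hr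
    push_cast at hl hr
    rcases le_abs.1 ht with h | h <;> linarith
  · simp
  · rfl

lemma normY1_sq {n : ℕ} (y : Fin n → ℝ) :
    normY1 y ^ 2 = 1 / (2 * (n : ℝ)) * ∑ k, y k ^ 2 :=
  Real.sq_sqrt (by positivity)

/-- Every spike vector supported at a single training input is realized by a spline. -/
lemma single_mem_splineImage {p n : ℕ} (hp₀ : 0 < p) (hp : 3 ≤ p) {x : Fin n → ℝ}
    (hx : Function.Injective x) (k : Fin n) (b : ℝ) :
    Pi.single k b ∈ splineImage p n hp₀ x := by
  obtain ⟨δ, hδ, hgap⟩ := exists_pos_gap hx k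
  refine ⟨fun j => if j.val = 1 then b else 0, fun j => x k + δ * ((j.val : ℝ) - 1), ?_, ?_⟩
  · intro i j hij
    have : (i.val : ℝ) < (j.val : ℝ) := by exact_mod_cast hij
    dsimp only
    nlinarith
  · funext i
    by_cases hik : i = k
    · subst hik
      simpa [splinePsi] using (splineVal_hat_center hp₀ hp b (x i) hδ).symm
    · simpa [splinePsi, hik] using (splineVal_hat_of_le hp₀ hp b (x k) hδ (hgap i hik)).symm

lemma splineLossInf_le {p n : ℕ} (hp : 0 < p) {x z : Fin n → ℝ}
    (hz : z ∈ splineImage p n hp x) (y : Fin n → ℝ) :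
    splineLossInf p n hp x y ≤ normY1 (z - y) ^ 2 := by
  obtain ⟨β, γ, hγ, rfl⟩ := hz
  refine csInf_le ⟨0, ?_⟩ ⟨β, γ, hγ, rfl⟩
  rintro r ⟨β', γ', -, rfl⟩
  positivity

/-- Fitting the label of largest modulus exactly reduces the loss by a factor `1 - 1 / n`. -/
lemma splineLossInf_le_mul {p n : ℕ} (hp₀ : 0 < p) (hp : 3 ≤ p) (hn : 0 < n) {x : Fin n → ℝ}
    (hx : Function.Injective x) (y : Fin n → ℝ) :
    splineLossInf p n hp₀ x y ≤ (1 - 1 / (n : ℝ)) * normY1 y ^ 2 := by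
  have hn' : (0 : ℝ) < n := by exact_mod_cast hn
  obtain ⟨k, -, hk⟩ := Finset.exists_max_image Finset.univ (fun i => y i ^ 2)
    ⟨⟨0, hn⟩, Finset.mem_univ _⟩
  refine (splineLossInf_le _ (single_mem_splineImage hp₀ hp hx k (y k)) y).trans ?_
  have hmax : ∑ i, y i ^ 2 ≤ n * y k ^ 2 := by
    simpa using Finset.sum_le_card_nsmul Finset.univ (fun i => y i ^ 2) _ hk
  have hsum : ∑ i, ((Pi.single k (y k) : Fin n → ℝ) - y) i ^ 2 = ∑ i, y i ^ 2 - y k ^ 2 := by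
    rw [← Finset.add_sum_erase _ _ (Finset.mem_univ k),
      ← Finset.add_sum_erase _ (fun i => y i ^ 2) (Finset.mem_univ k)]
    have : ∀ i ∈ Finset.univ.erase k,
        ((Pi.single k (y k) : Fin n → ℝ) - y) i ^ 2 = y i ^ 2 := by
      intro i hi
      simp [Finset.ne_of_mem_erase hi]
    rw [Finset.sum_congr rfl this]
    simp
  rw [normY1_sq, normY1_sq, hsum, mul_left_comm]
  refine mul_le_mul_of_nonneg_left ?_ (by positivity)
  have : (∑ i, y i ^ 2) / n ≤ y k ^ 2 := (div_le_iff₀' hn').2 hmax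
  calc ∑ i, y i ^ 2 - y k ^ 2 ≤ ∑ i, y i ^ 2 - (∑ i, y i ^ 2) / n := by linarith
    _ = (1 - 1 / (n : ℝ)) * ∑ i, y i ^ 2 := by ring

theorem freeknot_conicity_and_expressiveness
    (p n : ℕ) (hp : 3 ≤ p) (hn : 2 ≤ n)
    (x : Fin n → ℝ) (hx : StrictMono x) :
    (∀ y ∈ splineImage p n (by omega) x, ∀ s : ℝ, 0 < s →
      s • y ∈ splineImage p n (by omega) x) ∧
    (∀ y : Fin n → ℝ, y ≠ 0 →
      splineLossInf p n (by omega) x y < normY1 y ^ 2) ∧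
    splineTheta p n (by omega) x ≤ 1 - 1 / (n : ℝ) := by
  have hn' : (0 : ℝ) < n := by exact_mod_cast (by omega : 0 < n)
  refine ⟨?_, ?_, ?_⟩
  · rintro y ⟨β, γ, hγ, rfl⟩ s -
    refine ⟨s • β, γ, hγ, ?_⟩
    funext k
    simp [splinePsi, splineVal_smul]
  · intro y hy
    refine (splineLossInf_le_mul _ hp (by omega) hx.injective y).trans_lt ?_
    have hpos : 0 < normY1 y ^ 2 := by
      rw [normY1_sq]
      obtain ⟨i, hi⟩ := Function.ne_iff.1 hy
      have : 0 < ∑ k, y k ^ 2 := Finset.sum_pos' (fun _ _ => sq_nonneg _)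
        ⟨i, Finset.mem_univ i, sq_pos_of_ne_zero hi⟩
      positivity
    have : 0 < 1 / (n : ℝ) := by positivity
    nlinarith
  · refine Real.sSup_le ?_ ?_
    · rintro t ⟨y, hy, rfl⟩
      simpa [hy] using splineLossInf_le_mul _ hp (by omega) hx.injective y
    · have : 1 / (n : ℝ) ≤ 1 := (div_le_one hn').2 (by exact_mod_cast (by omega : 1 ≤ n))
      linarith
end
end
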